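/- Let K be a field, and let H ⊆ G be finite simple connected graphs on the same vertex set (E(H) ⊆ E(G)). Suppose L > 0 is an integer such that for every edge (x,y) of G there is a path in H from x to y of length at most L. Then for every integer q > L, the K-linear map ε_K(H)/C^q_K(H) → ε_K(G)/C^q_K(G) induced by the inclusion of edge sets is surjective. -/

import Mathlib

open Filter Function Set
open scoped Classical TensorProduct Pointwise symmDiff

universe u

namespace GraphSeqPaper

/-- The space of `K`-valued antisymmetric functions supported on the (oriented) edges of `G`:
the `K`-vector space spanned by the edges with the convention `(x,y) = -(y,x)`. -/
def edgeSpace (K : Type*) [Field K] {V : Type u} (G : SimpleGraph V) :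
    Submodule K (V → V → K) where
  carrier := {f | (∀ x y, ¬ G.Adj x y → f x y = 0) ∧ ∀ x y, f x y = - f y x}
  add_mem' := by
    rintro f g ⟨hf1, hf2⟩ ⟨hg1, hg2⟩
    refine ⟨fun x y h => ?_, fun x y => ?_⟩
    · simp only [Pi.add_apply, hf1 x y h, hg1 x y h, add_zero]
    · simp only [Pi.add_apply, hf2 x y, hg2 x y]; ring
  zero_mem' := ⟨fun x y _ => rfl, fun x y => by simp⟩
  smul_mem' := by
    rintro c f ⟨hf1, hf2⟩
    refine ⟨fun x y h => ?_, fun x y => ?_⟩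
    · simp only [Pi.smul_apply, hf1 x y h, smul_zero]
    · simp only [Pi.smul_apply, hf2 x y, smul_neg]

lemma edgeSpace_mono (K : Type*) [Field K] {V : Type u} {H G : SimpleGraph V}
    (h : H ≤ G) : edgeSpace K H ≤ edgeSpace K G :=
  fun f hf => ⟨fun x y hxy => hf.1 x y fun ha => hxy (h ha), hf.2⟩

/-- The basis vector of `ε_K` associated to the oriented edge `(x,y)`. -/
noncomputable def edgeVec (K : Type*) [Field K] {V : Type u} (x y : V) : V → V → K :=
  fun a b => if a = x ∧ b = y then (1 : K) else if a = y ∧ b = x then (-1 : K) else 0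

/-- The vector of a walk `(x₀, x₁, …, x_l)`, namely `Σ_{i} (x_i, x_{i+1})`. -/
noncomputable def walkVec (K : Type*) [Field K] {V : Type u} {G : SimpleGraph V} :
    ∀ {x y : V}, G.Walk x y → (V → V → K)
  | _, _, SimpleGraph.Walk.nil => 0
  | _, _, @SimpleGraph.Walk.cons _ _ a b _ _ p => edgeVec K a b + walkVec K p

/-- `C^q_K(G)`: the subspace of `ε_K(G)` spanned by the vectors of cycles of length at most
`q`. -/
noncomputable def cycleSpace (K : Type*) [Field K] {V : Type u} (G : SimpleGraph V) (q : ℕ) :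
    Submodule K (V → V → K) :=
  Submodule.span K
    {f | ∃ (x : V) (c : G.Walk x x), c.IsCycle ∧ c.length ≤ q ∧ f = walkVec K c}

/-- A graph sequence: finite simple graphs, of uniformly bounded vertex degrees, whose number
of vertices tends to infinity. -/
def IsGraphSeq (V : ℕ → Type u) (G : ∀ n, SimpleGraph (V n)) : Prop :=
  (∀ n, Finite (V n)) ∧
    (∃ D : ℕ, ∀ n (x : V n), ((G n).neighborSet x).ncard ≤ D) ∧
      Tendsto (fun n => Nat.card (V n)) atTop atTop

/-- `ℋ ≺ 𝒢`: there is an integer `L > 0` with `d_{G_n}(x,y) ≤ L · d_{H_n}(x,y)` for all `n`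
and all vertices `x, y`. -/
def Prec {V : ℕ → Type u} (H G : ∀ n, SimpleGraph (V n)) : Prop :=
  ∃ L : ℕ, 0 < L ∧ ∀ n (x y : V n), (G n).dist x y ≤ L * (H n).dist x y

/-- `𝒢 ≃ ℋ`: `ℋ ≺ 𝒢` and `𝒢 ≺ ℋ`. -/
def GEquiv {V : ℕ → Type u} (G H : ∀ n, SimpleGraph (V n)) : Prop :=
  Prec H G ∧ Prec G H

/-- The edge number `e(𝒢) = liminf |E(G_n)|/|V(G_n)|`. -/
noncomputable def edgeNum {V : ℕ → Type u} (G : ∀ n, SimpleGraph (V n)) : ℝ :=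
  liminf (fun n => ((G n).edgeSet.ncard : ℝ) / (Nat.card (V n) : ℝ)) atTop

/-- The cost `c(𝒢) = inf { e(ℋ) : ℋ ≃ 𝒢 }`. -/
noncomputable def cost {V : ℕ → Type u} (G : ∀ n, SimpleGraph (V n)) : ℝ :=
  sInf {r : ℝ | ∃ H : ∀ n, SimpleGraph (V n), IsGraphSeq V H ∧ GEquiv G H ∧ r = edgeNum H}

/-- `s^q_K(𝒢) = liminf (|E(G_n)| - dim_K C^q_K(G_n))/|V(G_n)| - 1`. -/
noncomputable def sInv (K : Type*) [Field K] {V : ℕ → Type u}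
    (G : ∀ n, SimpleGraph (V n)) (q : ℕ) : ℝ :=
  liminf (fun n =>
    (((G n).edgeSet.ncard : ℝ) - (Module.finrank K (cycleSpace K (G n) q) : ℝ)) /
      (Nat.card (V n) : ℝ)) atTop - 1

/-- `β_K(𝒢) = inf_q s^q_K(𝒢)`. -/
noncomputable def beta (K : Type*) [Field K] {V : ℕ → Type u}
    (G : ∀ n, SimpleGraph (V n)) : ℝ :=
  ⨅ q : ℕ, sInv K G q

/-- A large girth sequence: for every `k ≥ 1`, all but finitely many `G_n` contain no cycle of
length at most `k`. -/
def LargeGirth {V : ℕ → Type u} (G : ∀ n, SimpleGraph (V n)) : Prop :=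
  ∀ k : ℕ, 1 ≤ k → ∃ N : ℕ, ∀ n, N ≤ n →
    ∀ (x : V n) (c : (G n).Walk x x), c.IsCycle → k < c.length

/-- The set of edges of `G` whose two endpoints lie in different classes of the partition given
by the fibres of `P`. -/
def crossEdges {V : Type u} (G : SimpleGraph V) (P : V → ℕ) : Set (Sym2 V) :=
  {e | e ∈ G.edgeSet ∧ ∃ x ∈ e, ∃ y ∈ e, P x ≠ P y}

/-- Hyperfiniteness of a graph sequence. -/
def Hyperfinite {V : ℕ → Type u} (G : ∀ n, SimpleGraph (V n)) : Prop :=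
  ∀ ε : ℝ, 0 < ε → ∃ Kb : ℕ, ∃ P : ∀ n, V n → ℕ,
    (∀ n i, {x : V n | P n x = i}.ncard ≤ Kb) ∧
      liminf (fun n => ((crossEdges (G n) (P n)).ncard : ℝ) / (Nat.card (V n) : ℝ)) atTop ≤ ε

/-- The Cayley graph of a group with respect to a (symmetric) set `T`:
`x ~ y` iff `x ≠ y` and `y x⁻¹ ∈ T` (or `x y⁻¹ ∈ T`). -/
def cayley (Q : Type u) [Group Q] (T : Set Q) : SimpleGraph Q :=
  SimpleGraph.fromRel (fun x y => y * x⁻¹ ∈ T)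

/-- The Cayley graph of the quotient `Γ ⧸ N` with respect to the image of `S`. -/
def cayleyQuot {Γ : Type u} [Group Γ] (N : Subgroup Γ) (hN : N.Normal) (S : Set Γ) :
    SimpleGraph (Γ ⧸ N) :=
  haveI := hN
  cayley (Γ ⧸ N) ((fun g => (QuotientGroup.mk g : Γ ⧸ N)) '' S)

/-- The minimal number of generators of a group. -/
noncomputable def minGens (Λ : Type u) [Group Λ] : ℕ :=
  sInf {d : ℕ | ∃ T : Set Λ, T.Finite ∧ T.ncard = d ∧ Subgroup.closure T = ⊤}

/-- A group is finitely presented. -/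
def FinitelyPresentedGroup (Γ : Type u) [Group Γ] : Prop :=
  ∃ (n : ℕ) (f : FreeGroup (Fin n) →* Γ) (R : Set (FreeGroup (Fin n))),
    Surjective f ∧ R.Finite ∧ f.ker = Subgroup.normalClosure R

/-- Amenability via the Følner condition. -/
def IsAmenableFolner (Γ : Type u) [Group Γ] : Prop :=
  ∀ F : Set Γ, F.Finite → ∀ ε : ℝ, 0 < ε →
    ∃ A : Set Γ, A.Finite ∧ A.Nonempty ∧
      ∀ s ∈ F, (((s • A) ∆ A).ncard : ℝ) ≤ ε * A.ncard

/-- The set of edges of `G` joining `F` to its complement. -/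
def edgeBoundary {V : Type u} (G : SimpleGraph V) (F : Set V) : Set (Sym2 V) :=
  {e | e ∈ G.edgeSet ∧ ∃ x ∈ e, ∃ y ∈ e, x ∈ F ∧ y ∉ F}

lemma edgeVec_swap (K : Type*) [Field K] {V : Type u} {x y : V} (h : x ≠ y) :
    edgeVec K y x = -edgeVec K x y := by
  funext a b
  simp only [edgeVec, Pi.neg_apply]
  split_ifs with h₁ h₂ h₂
  · exact absurd (h₂.1.symm.trans h₁.1) h
  all_goals simp

lemma edgeVec_mem_edgeSpace (K : Type*) [Field K] {V : Type u} {G : SimpleGraph V} {x y : V}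
    (h : G.Adj x y) : edgeVec K x y ∈ edgeSpace K G := by
  refine ⟨fun a b hab => ?_, fun a b => ?_⟩
  · have h₁ : ¬ (a = x ∧ b = y) := fun e => hab (by rw [e.1, e.2]; exact h)
    have h₂ : ¬ (a = y ∧ b = x) := fun e => hab (by rw [e.1, e.2]; exact h.symm)
    simp only [edgeVec, if_neg h₁, if_neg h₂]
  · have hne := h.ne
    have := congrFun (congrFun (edgeVec_swap K hne) a) b
    rw [Pi.neg_apply, Pi.neg_apply] at this
    rw [← neg_eq_iff_eq_neg, ← this]
    simp only [edgeVec, and_comm]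

lemma walkVec_mem_edgeSpace (K : Type*) [Field K] {V : Type u} {G : SimpleGraph V} {x y : V}
    (p : G.Walk x y) : walkVec K p ∈ edgeSpace K G := by
  induction p with
  | nil => exact Submodule.zero_mem _
  | cons h p ih => exact Submodule.add_mem _ (edgeVec_mem_edgeSpace K h) ih

lemma walkVec_mapLe (K : Type*) [Field K] {V : Type u} {H G : SimpleGraph V} (hHG : H ≤ G)
    {x y : V} (p : H.Walk x y) : walkVec K (p.mapLe hHG) = walkVec K p := by
  induction p with
  | nil => rfl
  | cons h p ih => exact congrArg (edgeVec K _ _ + ·) ih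

lemma cycleSpace_mono (K : Type*) [Field K] {V : Type u} {H G : SimpleGraph V} (hHG : H ≤ G)
    (q : ℕ) : cycleSpace K H q ≤ cycleSpace K G q := by
  refine Submodule.span_mono ?_
  rintro f ⟨x, c, hc, hq, rfl⟩
  exact ⟨x, c.mapLe hHG, (SimpleGraph.Walk.isCycle_mapLe hHG).2 hc, by simpa using hq,
    (walkVec_mapLe K hHG c).symm⟩

/-- The vectors of the edges of `G` span `edgeSpace K G`. -/
lemma edgeSpace_le_of_edgeVec_mem (K : Type*) [Field K] {V : Type u} [Fintype V]
    {G : SimpleGraph V} {S : Submodule K (V → V → K)}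
    (hS : ∀ x y, G.Adj x y → edgeVec K x y ∈ S) : edgeSpace K G ≤ S := by
  intro f hf
  let _ : LinearOrder V := linearOrderOfSTO WellOrderingRel
  have key : f = ∑ x, ∑ y, (if x < y then f x y else 0) • edgeVec K x y := by
    funext a b
    have hdiag (a : V) : f a a = 0 := hf.1 a a (G.loopless.irrefl a)
    have hterm (x y : V) : (if x < y then f x y else 0) * edgeVec K x y a b =
        (if x = a then if y = b then (if a < b then f a b else 0) else 0 else 0) +
        (if x = b then if y = a then (if b < a then f a b else 0) else 0 else 0) := by
      have hab := hf.2 b a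
      simp only [edgeVec]
      split_ifs <;> grind
    simp only [Finset.sum_apply, Pi.smul_apply, smul_eq_mul, hterm, Finset.sum_add_distrib]
    simp only [Finset.sum_ite_eq', Finset.sum_ite_irrel, Finset.sum_const_zero,
      Finset.mem_univ, if_true]
    rcases lt_trichotomy a b with h | rfl | h
    · simp [h, h.not_gt]
    · simp [hdiag]
    · simp [h, h.not_gt]
  rw [key]
  refine Submodule.sum_mem _ fun x _ => Submodule.sum_mem _ fun y _ => ?_
  by_cases h : G.Adj x y
  · exact Submodule.smul_mem _ _ (hS x y h)
  · rw [hf.1 x y h, ite_self, zero_smul]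
    exact Submodule.zero_mem _

lemma edgeVec_mem_edgeSpace_sup_cycleSpace (K : Type*) [Field K] {V : Type u}
    {H G : SimpleGraph V} (hHG : H ≤ G) {q : ℕ} {x y : V} (hxy : G.Adj x y)
    (w : H.Walk x y) (hw : w.length < q) :
    edgeVec K x y ∈ edgeSpace K H ⊔ cycleSpace K G q := by
  by_cases hH : H.Adj x y
  · exact Submodule.mem_sup_left (edgeVec_mem_edgeSpace K hH)
  let p := w.bypass
  have hcyc : (SimpleGraph.Walk.cons hxy.symm (p.mapLe hHG)).IsCycle := by
    rw [SimpleGraph.Walk.cons_isCycle_iff]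
    refine ⟨(SimpleGraph.Walk.isPath_mapLe hHG).2 w.bypass_isPath, fun he => hH ?_⟩
    rw [SimpleGraph.Walk.edges_mapLe_eq_edges] at he
    exact (p.adj_of_mem_edges he).symm
  have hlen : (SimpleGraph.Walk.cons hxy.symm (p.mapLe hHG)).length ≤ q := by
    have : p.length ≤ w.length := w.length_bypass_le_length
    simp only [SimpleGraph.Walk.length_cons, SimpleGraph.Walk.length_map]
    omega
  have hmem : edgeVec K y x + walkVec K p ∈ cycleSpace K G q := by
    rw [← walkVec_mapLe K hHG p]
    exact Submodule.subset_span ⟨y, _, hcyc, hlen, rfl⟩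
  refine Submodule.mem_sup.2
    ⟨walkVec K p, walkVec_mem_edgeSpace K p, -(edgeVec K y x + walkVec K p),
      Submodule.neg_mem _ hmem, ?_⟩
  rw [edgeVec_swap K hxy.ne]
  abel

theorem induced_quotient_map_surjective (K : Type*) [Field K] {V : Type u} [Fintype V]
    (H G : SimpleGraph V) (hHG : H ≤ G) (hGc : G.Connected) (hHc : H.Connected)
    (L : ℕ) (hL : 0 < L)
    (hpath : ∀ x y : V, G.Adj x y → ∃ w : H.Walk x y, w.length ≤ L)
    (q : ℕ) (hq : L < q) :
    cycleSpace K H q ≤ cycleSpace K G q ∧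
      Function.Surjective
        (⇑(((cycleSpace K G q).comap (edgeSpace K G).subtype).mkQ.comp
            (Submodule.inclusion (edgeSpace_mono K hHG)))) := by
  refine ⟨cycleSpace_mono K hHG q, fun z => ?_⟩
  obtain ⟨⟨f, hf⟩, rfl⟩ := Submodule.mkQ_surjective _ z
  have hle : edgeSpace K G ≤ edgeSpace K H ⊔ cycleSpace K G q :=
    edgeSpace_le_of_edgeVec_mem K fun x y hxy =>
      let ⟨w, hw⟩ := hpath x y hxy
      edgeVec_mem_edgeSpace_sup_cycleSpace K hHG hxy w (hw.trans_lt hq)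
  obtain ⟨h, hh, c, hc, rfl⟩ := Submodule.mem_sup.1 (hle hf)
  refine ⟨⟨h, hh⟩, (Submodule.Quotient.eq _).2 ?_⟩
  rw [Submodule.mem_comap]
  have : h - (h + c) = -c := by abel
  simpa [this] using hc

end GraphSeqPaper
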